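/- arXiv:2311.06484 — 2 statements merged into one kernel-verified Lean document; each statement's English description precedes it below -/
import Mathlib

section
/- Let p > 1, set α = (p+1)/2, and let t ∈ (0,1). For any real numbers ã, b̃ > 0 satisfying ã + b̃ = 1 - 1/p, there exist exponents q, r ∈ [1, ∞) with 1/q + 1/r - 1/p = 1 such that C(p,q,r)^{-αp/(p-1)} · ã^{p(q-1)/(q(p-1))} · b̃^{p(r-1)/(r(p-1))} ≥ 1 - 1/p, where C(p,q,r) is the sharp Young constant. -/
open MeasureTheory Real

noncomputable section

/-- `f` is a probability density function on `ℝ^d`. -/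
def IsDensity (d : ℕ) (f : (Fin d → ℝ) → ℝ) : Prop :=
  Measurable f ∧ (∀ x, 0 ≤ f x) ∧ ∫ x : Fin d → ℝ, f x = 1

/-- The `p`-Rényi entropy `H_p(f) = (1/(1-p)) log ∫ f^p`. -/
def renyiH (d : ℕ) (p : ℝ) (f : (Fin d → ℝ) → ℝ) : ℝ :=
  (1 / (1 - p)) * Real.log (∫ x : Fin d → ℝ, f x ^ p)

/-- The `p`-Rényi entropy power `V_p(f) = exp((2/d) H_p(f))`. -/
def renyiV (d : ℕ) (p : ℝ) (f : (Fin d → ℝ) → ℝ) : ℝ :=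
  Real.exp ((2 / (d : ℝ)) * renyiH d p f)

/-- The differential (Shannon) entropy `H(f) = -∫ f log f`. -/
def shannonH (d : ℕ) (f : (Fin d → ℝ) → ℝ) : ℝ :=
  -∫ x : Fin d → ℝ, f x * Real.log (f x)

/-- The (Shannon) entropy power `V(f) = exp((2/d) H(f))`. -/
def shannonV (d : ℕ) (f : (Fin d → ℝ) → ℝ) : ℝ :=
  Real.exp ((2 / (d : ℝ)) * shannonH d f)

/-- Convolution of two densities on `ℝ^d`: `(f ⋆ g)(z) = ∫ f(x) g(z - x) dx`. -/
def conv (d : ℕ) (f g : (Fin d → ℝ) → ℝ) : (Fin d → ℝ) → ℝ :=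
  fun z => ∫ x : Fin d → ℝ, f x * g (z - x)

/-- The density `x ↦ t^{-d/2} f(x/√t)` of `√t · X` when `X ~ f`. -/
def scaleDensity (d : ℕ) (t : ℝ) (f : (Fin d → ℝ) → ℝ) : (Fin d → ℝ) → ℝ :=
  fun x => t ^ (-(d : ℝ) / 2) * f ((Real.sqrt t)⁻¹ • x)

/-- The density of `√t · X + √(1-t) · Y` for independent `X ~ f`, `Y ~ g`. -/
def wconv (d : ℕ) (t : ℝ) (f g : (Fin d → ℝ) → ℝ) : (Fin d → ℝ) → ℝ :=
  conv d (scaleDensity d t f) (scaleDensity d (1 - t) g)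

/-- `A_s = s^{1/s} / (s')^{1/s'}` where `s' = s/(s-1)`; the limiting value `A_1 = 1`
is obtained automatically since `(1/0)^0 = 1` under Lean's conventions. -/
def youngA (s : ℝ) : ℝ := s ^ (1 / s) / (s / (s - 1)) ^ (1 - 1 / s)

/-- The sharp Young constant `C(p,q,r) = A_q A_r / A_p`. -/
def youngC (p q r : ℝ) : ℝ := youngA q * youngA r / youngA p

/-- Power series of `u + (1 - u) log (1 - u)` on `[0, 1]`. -/
lemma hasSum_add_one_sub_mul_log {u : ℝ} (h0 : 0 ≤ u) (h1 : u ≤ 1) :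
    HasSum (fun n : ℕ => u ^ (n + 2) / (((n : ℝ) + 2) * (n + 1))) (u + (1 - u) * log (1 - u)) := by
  rcases h1.lt_or_eq with h | rfl
  · have hs := hasSum_pow_div_log_of_abs_lt_one (abs_lt.2 ⟨by linarith, h⟩)
    have hs' := (hasSum_nat_add_iff' 1).2 hs
    have hsub := (hs.mul_left u).sub hs'
    simp only [Finset.range_one, Finset.sum_singleton] at hsub
    convert hsub using 1
    · rfl
    · funext n
      push_cast
      field_simp
      ring
    · push_cast
      ring
  · rw [hasSum_iff_tendsto_nat_of_nonneg (fun n => by positivity)]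
    have hpartial : ∀ N : ℕ,
        ∑ n ∈ Finset.range N, (1 : ℝ) ^ (n + 2) / (((n : ℝ) + 2) * (n + 1)) =
          1 - 1 / ((N : ℝ) + 1) := by
      intro N
      induction N with
      | zero => simp
      | succ k ih =>
        rw [Finset.sum_range_succ, ih]
        push_cast
        field_simp
        ring
    simp only [hpartial]
    simpa using tendsto_one_div_add_atTop_nhds_zero_nat.const_sub (1 : ℝ)

lemma two_sub_mul_tsum_pow_le {s : ℕ → ℝ} {S T c : ℝ} (hS : HasSum s S)
    (hT : HasSum (fun n => c ^ n * s n) T) (h0 : 0 ≤ c) (h1 : c ≤ 1)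
    (hs : ∀ n, s n ≤ 2 * s (n + 1)) : (2 - c) * T ≤ S := by
  have hS' := (((hasSum_nat_add_iff' 1).2 hS).mul_left 2).sub hS
  have hT' := (((hasSum_nat_add_iff' 1).2 hT).mul_left 2).sub (hT.mul_left c)
  have hle := hasSum_le (fun n => ?_) hT' hS'
  · simp only [Finset.range_one, Finset.sum_singleton, pow_zero] at hle
    linarith
  · have hpow : c ^ (n + 1) ≤ 1 := pow_le_one₀ h0 h1
    calc 2 * (c ^ (n + 1) * s (n + 1)) - c * (c ^ n * s n)
        = c ^ (n + 1) * (2 * s (n + 1) - s n) := by ring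
      _ ≤ 1 * (2 * s (n + 1) - s n) :=
        mul_le_mul_of_nonneg_right hpow (by linarith [hs n])
      _ = 2 * s (n + 1) - s n := one_mul _

lemma one_sub_pow_sub_pow_div_le {x y : ℝ} (hx : 0 ≤ x) (hy : 0 ≤ y) (hxy : x + y = 1) (n : ℕ) :
    (1 - x ^ (n + 2) - y ^ (n + 2)) / (((n : ℝ) + 2) * (n + 1)) ≤
      2 * ((1 - x ^ (n + 1 + 2) - y ^ (n + 1 + 2)) /
        ((((n + 1 : ℕ) : ℝ) + 2) * ((n + 1 : ℕ) + 1))) := by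
  rcases n.eq_zero_or_pos with rfl | hn
  · obtain rfl : y = 1 - x := by linarith
    norm_num
    apply le_of_eq
    ring
  · have hn' : (1 : ℝ) ≤ n := by exact_mod_cast hn
    have hx1 : x ≤ 1 := by linarith
    have hy1 : y ≤ 1 := by linarith
    have hxn : x ^ (n + 1 + 2) ≤ x ^ (n + 2) := pow_le_pow_of_le_one hx hx1 (by lia)
    have hyn : y ^ (n + 1 + 2) ≤ y ^ (n + 2) := pow_le_pow_of_le_one hy hy1 (by lia)
    have hx2 : x ^ (n + 2) ≤ x := by simpa using pow_le_pow_of_le_one hx hx1 (show 1 ≤ n + 2 by lia)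
    have hy2 : y ^ (n + 2) ≤ y := by simpa using pow_le_pow_of_le_one hy hy1 (show 1 ≤ n + 2 by lia)
    push_cast
    rw [← mul_div_assoc, div_le_div_iff₀ (by positivity) (by positivity)]
    have key : (1 - x ^ (n + 2) - y ^ (n + 2)) * ((n : ℝ) + 3) ≤
        (1 - x ^ (n + 1 + 2) - y ^ (n + 1 + 2)) * (2 * (n + 1)) :=
      mul_le_mul (by linarith) (by linarith) (by linarith) (by linarith)
    nlinarith

lemma entropy_inequality {a b : ℝ} (ha : 0 < a) (hb : 0 < b) (hc : a + b < 1) :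
    0 ≤ (2 - (a + b)) * ((1 - a) * log (1 - a) + (1 - b) * log (1 - b)
        - (1 - (a + b)) * log (1 - (a + b)))
      - (a + b) * (a * log a + b * log b - (a + b) * log (a + b)) := by
  set c := a + b with hcdef
  have hc0 : 0 < c := by positivity
  have hxy : a / c + b / c = 1 := by rw [← add_div, div_self hc0.ne']
  have hx0 : 0 < a / c := by positivity
  have hy0 : 0 < b / c := by positivity
  have hS := ((hasSum_add_one_sub_mul_log zero_le_one le_rfl).sub
    (hasSum_add_one_sub_mul_log hx0.le (by linarith))).sub
    (hasSum_add_one_sub_mul_log hy0.le (by linarith))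
  have hT := (((hasSum_add_one_sub_mul_log hc0.le hc.le).sub
    (hasSum_add_one_sub_mul_log ha.le (by linarith))).sub
    (hasSum_add_one_sub_mul_log hb.le (by linarith))).div_const (c ^ 2)
  have hle := two_sub_mul_tsum_pow_le
    (s := fun n => (1 - (a / c) ^ (n + 2) - (b / c) ^ (n + 2)) / (((n : ℝ) + 2) * (n + 1)))
    (c := c) (by simpa only [one_pow, sub_div] using hS) (by
      refine hT.congr_fun fun n => ?_
      rw [div_pow, div_pow]
      field_simp
      ring) hc0.le hc.le (one_sub_pow_sub_pow_div_le hx0.le hy0.le hxy)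
  rw [show 1 - a / c = b / c by linarith, show 1 - b / c = a / c by linarith,
    log_div ha.ne' hc0.ne', log_div hb.ne' hc0.ne', ← mul_div_assoc,
    div_le_iff₀ (by positivity)] at hle
  have hrhs : (1 + (1 - 1) * log (1 - 1) - (a / c + b / c * (log b - log c)) -
      (b / c + a / c * (log a - log c))) * c ^ 2 =
      -(c * (a * log a + b * log b - c * log c)) := by
    rw [hcdef]
    field_simp
    ring
  rw [hrhs] at hle
  rw [show c + (1 - c) * log (1 - c) - (a + (1 - a) * log (1 - a)) -
    (b + (1 - b) * log (1 - b)) = -((1 - a) * log (1 - a) + (1 - b) * log (1 - b)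
        - (1 - c) * log (1 - c)) by rw [hcdef]; ring] at hle
  linarith

lemma youngA_one_div_one_sub {u : ℝ} (h0 : 0 < u) (h1 : u < 1) :
    youngA (1 / (1 - u)) = exp (u * log u - (1 - u) * log (1 - u)) := by
  have h : 0 < 1 - u := by linarith
  have hu : 1 / (1 - u) / (1 / (1 - u) - 1) = 1 / u := by
    rw [show 1 / (1 - u) - 1 = u / (1 - u) by field_simp; ring]
    field_simp
  rw [youngA, hu, one_div_one_div, sub_sub_cancel, rpow_def_of_pos (by positivity),
    rpow_def_of_pos (by positivity), ← exp_sub, one_div, one_div, log_inv, log_inv]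
  congr 1
  ring

/-- **Sharp Young's constant with weight (Proposition 1).** For `p > 1`,
`α = (p+1)/2`, `t ∈ (0,1)`, and `ã, b̃ > 0` with `ã + b̃ = 1 - 1/p`, there exist
`q, r ∈ [1, ∞)` with `1/q + 1/r - 1/p = 1` such that
`C(p,q,r)^{-αp/(p-1)} ã^{p(q-1)/(q(p-1))} b̃^{p(r-1)/(r(p-1))} ≥ 1 - 1/p`. -/
theorem sharp_young_constant_weighted (p α t a b : ℝ) (hp : 1 < p)
    (hα : α = (p + 1) / 2) (ht : t ∈ Set.Ioo (0 : ℝ) 1)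
    (ha : 0 < a) (hb : 0 < b) (hab : a + b = 1 - 1 / p) :
    ∃ q r : ℝ, 1 ≤ q ∧ 1 ≤ r ∧ 1 / q + 1 / r - 1 / p = 1 ∧
      youngC p q r ^ (-(α * p) / (p - 1)) *
        a ^ (p * (q - 1) / (q * (p - 1))) * b ^ (p * (r - 1) / (r * (p - 1)))
      ≥ 1 - 1 / p := by
  obtain ⟨c, hc⟩ : ∃ c, c = a + b := ⟨_, rfl⟩
  have hp0 : 0 < p := by linarith
  have hcp : c = 1 - 1 / p := hc.trans hab
  have hc0 : 0 < c := by linarith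
  have hc1 : 0 < 1 - c := by
    rw [hcp, sub_sub_cancel]
    positivity
  have ha1 : 0 < 1 - a := by linarith
  have hb1 : 0 < 1 - b := by linarith
  obtain rfl : p = 1 / (1 - c) := by rw [hcp, sub_sub_cancel, one_div_one_div]
  have hexp : ∀ u : ℝ, 0 < 1 - u → 1 / (1 - c) * (1 / (1 - u) - 1) /
      (1 / (1 - u) * (1 / (1 - c) - 1)) = u / c := by
    intro u hu
    rw [show 1 / (1 - u) - 1 = u / (1 - u) by field_simp; ring,
      show 1 / (1 - c) - 1 = c / (1 - c) by field_simp; ring]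
    field_simp
  refine ⟨1 / (1 - a), 1 / (1 - b), ?_, ?_, ?_, ?_⟩
  · rw [le_div_iff₀ ha1]
    linarith
  · rw [le_div_iff₀ hb1]
    linarith
  · rw [one_div_one_div, one_div_one_div, one_div_one_div]
    linarith
  · have hα' : -(α * (1 / (1 - c))) / (1 / (1 - c) - 1) = -((2 - c) / (2 * (1 - c) * c)) := by
      rw [hα, show 1 / (1 - c) - 1 = c / (1 - c) by field_simp; ring]
      field_simp
      ring
    rw [hexp a ha1, hexp b hb1, hα', ← hcp, youngC, youngA_one_div_one_sub ha (by linarith),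
      youngA_one_div_one_sub hb (by linarith), youngA_one_div_one_sub hc0 (by linarith),
      ← exp_add, ← exp_sub, ← exp_mul, rpow_def_of_pos ha, rpow_def_of_pos hb, ← exp_add,
      ← exp_add, ge_iff_le, ← log_le_iff_le_exp hc0]
    have key := entropy_inequality ha hb (by linarith)
    rw [← hc] at key
    have hdiv := div_nonneg key (show 0 ≤ 2 * (1 - c) * c by positivity)
    rw [← sub_nonneg]
    refine hdiv.trans_eq ?_
    field_simp
    ring
end
end

section
/- (Shannon–Stam entropy power inequality) Let d ≥ 1 and let f, g be probability density functions on ℝ^d with finite differential entropies, such that the convolution f⋆g has well-defined differential entropy. Then V(f⋆g) ≥ V(f) + V(g), where V(f) = exp((2/d) H(f)) is the entropy power and f⋆g is the density of the sum X + Y of independent random variables X ~ f, Y ~ g. -/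
open MeasureTheory Real

noncomputable section

open ProbabilityTheory Set Filter Topology
open scoped ENNReal NNReal

/-- The cumulative distribution function of the standard Gaussian. -/
def gaussCDF : ℝ → ℝ := cdf (gaussianReal 0 1)

/-- The inverse of `gaussCDF`, extended by `0` outside of its range. -/
def gaussQuantile : ℝ → ℝ := Function.extend gaussCDF id 0

lemma continuous_gaussianPDFReal : Continuous (gaussianPDFReal 0 1) := by
  rw [gaussianPDFReal_def]
  fun_prop

lemma gaussCDF_sub (a b : ℝ) :
    gaussCDF b = gaussCDF a + ∫ x in a..b, gaussianPDFReal 0 1 x := by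
  have key (a b : ℝ) (hab : a ≤ b) :
      ∫ x in a..b, gaussianPDFReal 0 1 x = gaussCDF b - gaussCDF a := by
    have h1 : gaussianReal 0 1 (Ioc a b) = ENNReal.ofReal (gaussCDF b - gaussCDF a) := by
      conv_lhs => rw [← measure_cdf (gaussianReal 0 1)]
      rw [StieltjesFunction.measure_Ioc]
      rfl
    rw [gaussianReal_apply_eq_integral 0 one_ne_zero] at h1
    rw [intervalIntegral.integral_of_le hab]
    refine (ENNReal.ofReal_eq_ofReal_iff ?_ ?_).1 h1
    · exact integral_nonneg fun x => gaussianPDFReal_nonneg _ _ _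
    · exact sub_nonneg.2 (monotone_cdf _ hab)
  rcases le_total a b with hab | hab
  · rw [key a b hab]; ring
  · rw [intervalIntegral.integral_symm, key b a hab]; ring

lemma hasDerivAt_gaussCDF (x : ℝ) : HasDerivAt gaussCDF (gaussianPDFReal 0 1 x) x := by
  have h : gaussCDF = fun b => gaussCDF 0 + ∫ x in (0 : ℝ)..b, gaussianPDFReal 0 1 x :=
    funext fun b => gaussCDF_sub 0 b
  rw [h]
  exact (intervalIntegral.integral_hasDerivAt_right
    (continuous_gaussianPDFReal.intervalIntegrable _ _)
    (continuous_gaussianPDFReal.stronglyMeasurableAtFilter _ _)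
    continuous_gaussianPDFReal.continuousAt).const_add _

lemma continuous_gaussCDF : Continuous gaussCDF :=
  continuous_iff_continuousAt.2 fun x => (hasDerivAt_gaussCDF x).continuousAt

lemma strictMono_gaussCDF : StrictMono gaussCDF :=
  strictMono_of_deriv_pos fun x => by
    rw [(hasDerivAt_gaussCDF x).deriv]
    exact gaussianPDFReal_pos _ _ _ one_ne_zero

lemma exists_gaussCDF_eq {u : ℝ} (hu : u ∈ Ioo (0 : ℝ) 1) : ∃ t, gaussCDF t = u := by
  obtain ⟨a, ha⟩ := ((tendsto_cdf_atBot (gaussianReal 0 1)).eventually_lt_const hu.1).exists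
  obtain ⟨b, hb⟩ := ((tendsto_cdf_atTop (gaussianReal 0 1)).eventually_const_lt hu.2).exists
  exact mem_range_of_exists_le_of_exists_ge continuous_gaussCDF ⟨a, ha.le⟩ ⟨b, hb.le⟩

lemma gaussQuantile_gaussCDF (t : ℝ) : gaussQuantile (gaussCDF t) = t :=
  strictMono_gaussCDF.injective.extend_apply _ _ _

lemma gaussCDF_gaussQuantile {u : ℝ} (hu : u ∈ Ioo (0 : ℝ) 1) :
    gaussCDF (gaussQuantile u) = u := by
  obtain ⟨t, rfl⟩ := exists_gaussCDF_eq hu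
  rw [gaussQuantile_gaussCDF]

lemma strictMonoOn_gaussQuantile : StrictMonoOn gaussQuantile (Ioo 0 1) := by
  intro u hu v hv huv
  rw [← strictMono_gaussCDF.lt_iff_lt, gaussCDF_gaussQuantile hu, gaussCDF_gaussQuantile hv]
  exact huv

lemma measurable_gaussQuantile : Measurable gaussQuantile :=
  (continuous_gaussCDF.measurableEmbedding strictMono_gaussCDF.injective).measurable_extend
    measurable_id measurable_const

lemma gaussCDF_mem_Ioo (t : ℝ) : gaussCDF t ∈ Ioo (0 : ℝ) 1 :=
  ⟨(cdf_nonneg _ (t - 1)).trans_lt (strictMono_gaussCDF (by linarith)),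
    (strictMono_gaussCDF (by linarith : t < t + 1)).trans_le (cdf_le_one _ _)⟩

lemma hasDerivAt_gaussQuantile {u : ℝ} (hu : u ∈ Ioo (0 : ℝ) 1) :
    HasDerivAt gaussQuantile (gaussianPDFReal 0 1 (gaussQuantile u))⁻¹ u := by
  refine HasDerivAt.of_local_left_inverse ?_ (hasDerivAt_gaussCDF _)
    (gaussianPDFReal_pos _ _ _ one_ne_zero).ne' ?_
  · refine strictMonoOn_gaussQuantile.continuousAt_of_image_mem_nhds
      (isOpen_Ioo.mem_nhds hu) ?_
    convert univ_mem
    refine eq_univ_of_forall fun t => ⟨gaussCDF t, gaussCDF_mem_Ioo t, gaussQuantile_gaussCDF t⟩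
  · filter_upwards [isOpen_Ioo.mem_nhds hu] with v hv using gaussCDF_gaussQuantile hv

/-- The monotone map which transports the probability density `f` on the line to the standard
Gaussian. -/
def gaussianize (f : ℝ → ℝ≥0∞) (x : ℝ) : ℝ := gaussQuantile (∫⁻ t in Iic x, f t).toReal

lemma measurable_gaussianize {P : Type*} [MeasurableSpace P] {f : P → ℝ → ℝ≥0∞}
    (hf : Measurable (Function.uncurry f)) :
    Measurable fun z : P × ℝ => gaussianize (f z.1) z.2 := by
  refine measurable_gaussQuantile.comp (Measurable.ennreal_toReal ?_)
  have h : (fun z : P × ℝ => ∫⁻ t in Iic z.2, f z.1 t) =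
      fun z => ∫⁻ t, {q : (P × ℝ) × ℝ | q.2 ≤ q.1.2}.indicator (fun q => f q.1.1 q.2) (z, t) := by
    ext z
    rw [← lintegral_indicator measurableSet_Iic]
    rfl
  rw [h]
  refine Measurable.lintegral_prod_right' (Measurable.indicator ?_ ?_)
  · exact hf.comp (by fun_prop : Measurable fun q : (P × ℝ) × ℝ => (q.1.1, q.2))
  · exact measurableSet_le (by fun_prop) (by fun_prop)

lemma exists_set_hasDerivAt_gaussianize {f : ℝ → ℝ≥0∞} (hf : Measurable f)
    (hf1 : ∫⁻ x, f x = 1) :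
    ∃ A : Set ℝ, MeasurableSet A ∧ (∀ᵐ x, x ∉ A → f x = 0) ∧
      (∀ x ∈ A, f x ≠ 0 ∧ f x ≠ ∞ ∧ HasDerivAt (gaussianize f)
        ((f x).toReal / gaussianPDFReal 0 1 (gaussianize f x)) x) ∧
      StrictMonoOn (gaussianize f) A := by
  set μ : Measure ℝ := volume.withDensity f with hμ
  have : IsProbabilityMeasure μ := ⟨by rw [hμ, withDensity_apply _ MeasurableSet.univ]; simpa⟩
  have hF : gaussianize f = fun x => gaussQuantile (cdf μ x) := by
    ext x
    rw [cdf_eq_real, Measure.real, hμ, withDensity_apply _ measurableSet_Iic, gaussianize]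
  have hder : ∀ᵐ x, HasDerivAt (cdf μ) (f x).toReal x := by
    have h1 := (cdf μ).ae_hasDerivAt
    rw [measure_cdf] at h1
    filter_upwards [h1, Measure.rnDeriv_withDensity volume hf] with x hx h2
    rwa [h2] at hx
  have htop : ∀ᵐ x, f x < ∞ := ae_lt_top hf (by rw [hf1]; exact ENNReal.one_ne_top)
  obtain ⟨B, hBae, hBm, hBsub⟩ := IsMeasurablyGenerated.exists_measurable_subset hder
  have hpos : ∀ x ∈ B ∩ {x | f x ≠ 0 ∧ f x ≠ ∞}, 0 < (f x).toReal := fun x hx =>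
    ENNReal.toReal_pos hx.2.1 hx.2.2
  have hmem : ∀ x ∈ B ∩ {x | f x ≠ 0 ∧ f x ≠ ∞}, cdf μ x ∈ Ioo (0 : ℝ) 1 := by
    intro x hx
    refine ⟨(cdf_nonneg μ x).lt_of_ne' fun h0 => ?_, (cdf_le_one μ x).lt_of_ne fun h1 => ?_⟩
    · have hmin : IsLocalMin (cdf μ) x := .of_forall fun y => by rw [h0]; exact cdf_nonneg μ y
      exact (hpos x hx).ne' (hmin.hasDerivAt_eq_zero (hBsub hx.1))
    · have hmax : IsLocalMax (cdf μ) x := .of_forall fun y => by rw [h1]; exact cdf_le_one μ y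
      exact (hpos x hx).ne' (hmax.hasDerivAt_eq_zero (hBsub hx.1))
  refine ⟨B ∩ {x | f x ≠ 0 ∧ f x ≠ ∞}, ?_, ?_, ?_, ?_⟩
  · exact hBm.inter (((hf (measurableSet_singleton 0)).compl).inter
      ((hf (measurableSet_singleton ∞)).compl))
  · filter_upwards [hBae, htop] with x hxB hxt hx
    by_contra h
    exact hx ⟨hxB, h, hxt.ne⟩
  · intro x hx
    refine ⟨hx.2.1, hx.2.2, ?_⟩
    rw [hF, div_eq_inv_mul]
    exact (hasDerivAt_gaussQuantile (hmem x hx)).comp x (hBsub hx.1)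
  · intro x hx y hy hxy
    rw [hF]
    refine strictMonoOn_gaussQuantile (hmem x hx) (hmem y hy)
      ((monotone_cdf μ hxy.le).lt_of_ne fun hE => ?_)
    have hconst : ∀ z ∈ Icc x y, cdf μ z = cdf μ x := fun z hz =>
      le_antisymm ((monotone_cdf μ hz.2).trans hE.ge) (monotone_cdf μ hz.1)
    have h1 : HasDerivWithinAt (cdf μ) 0 (Icc x y) x :=
      (hasDerivWithinAt_const x _ (cdf μ x)).congr hconst rfl
    exact (hpos x hx).ne' ((uniqueDiffOn_Icc hxy x (left_mem_Icc.2 hxy.le)).eq_deriv _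
      (hBsub hx.1).hasDerivWithinAt h1)

lemma lintegral_comp_gaussianize_le {f : ℝ → ℝ≥0∞} (hf : Measurable f) (hf1 : ∫⁻ x, f x = 1)
    (u : ℝ → ℝ≥0∞) :
    ∫⁻ x, u (gaussianize f x) * f x ≤ ∫⁻ x, u x * gaussianPDF 0 1 x := by
  obtain ⟨A, hA, hA0, hAd, hAm⟩ := exists_set_hasDerivAt_gaussianize hf hf1
  have hφ (x : ℝ) : 0 < gaussianPDFReal 0 1 x := gaussianPDFReal_pos _ _ _ one_ne_zero
  calc ∫⁻ x, u (gaussianize f x) * f x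
      = ∫⁻ x in A, u (gaussianize f x) * f x := by
        rw [← lintegral_indicator hA]
        refine lintegral_congr_ae ?_
        filter_upwards [hA0] with x hx
        by_cases h : x ∈ A <;> simp [h, hx]
    _ = ∫⁻ x in A, ENNReal.ofReal |(f x).toReal / gaussianPDFReal 0 1 (gaussianize f x)| *
          (u (gaussianize f x) * gaussianPDF 0 1 (gaussianize f x)) := by
        refine setLIntegral_congr_fun hA fun x hx => ?_
        obtain ⟨h0, ht, -⟩ := hAd x hx
        rw [abs_of_nonneg (div_nonneg ENNReal.toReal_nonneg (hφ _).le), mul_left_comm, gaussianPDF,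
          ← ENNReal.ofReal_mul (div_nonneg ENNReal.toReal_nonneg (hφ _).le),
          div_mul_cancel₀ _ (hφ _).ne', ENNReal.ofReal_toReal ht]
    _ = ∫⁻ x in gaussianize f '' A, u x * gaussianPDF 0 1 x :=
        (lintegral_image_eq_lintegral_abs_deriv_mul hA
          (fun x hx => (hAd x hx).2.2.hasDerivWithinAt) hAm.injOn (fun x => u x * gaussianPDF 0 1 x)).symm
    _ ≤ ∫⁻ x, u x * gaussianPDF 0 1 x := setLIntegral_le_lintegral _ _

/-- The Jacobian determinant of `(x, y) ↦ (x + y, b T y - a S x)`. -/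
lemma det_sum_sub (a b s t : ℝ) :
    (((ContinuousLinearMap.fst ℝ ℝ ℝ) + (ContinuousLinearMap.snd ℝ ℝ ℝ)).prod
      ((b * t) • (ContinuousLinearMap.snd ℝ ℝ ℝ) - (a * s) • (ContinuousLinearMap.fst ℝ ℝ ℝ))).det =
      b * t + a * s := by
  rw [ContinuousLinearMap.det, ← LinearMap.det_toMatrix (Module.Basis.finTwoProd ℝ),
    Matrix.det_fin_two]
  simp [LinearMap.toMatrix_apply]

/-- The pointwise comparison behind the one-dimensional inequality: weighted AM-GM, followed by
completing the square in the Gaussian exponents. -/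
lemma rpow_mul_rpow_mul_exp_le {l : ℝ} (h0 : 0 < l) (h1 : l < 1) {p q s t : ℝ} (hp : 0 < p)
    (hq : 0 < q) :
    p ^ (1 - l) * q ^ l * exp (√l * √(1 - l) * (s * t)) ≤
      √l ^ l * √(1 - l) ^ (1 - l) *
      ((√l * (q / gaussianPDFReal 0 1 t) + √(1 - l) * (p / gaussianPDFReal 0 1 s)) *
        gaussianPDFReal 0 1 (√l * t - √(1 - l) * s)) := by
  have hm : 0 < 1 - l := by linarith
  have hφ (x : ℝ) : 0 < gaussianPDFReal 0 1 x := gaussianPDFReal_pos _ _ _ one_ne_zero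
  have ha : 0 < √l := sqrt_pos.2 h0
  have hb : 0 < √(1 - l) := sqrt_pos.2 hm
  have hla : √l * √l = l := mul_self_sqrt h0.le
  have hlb : √(1 - l) * √(1 - l) = 1 - l := mul_self_sqrt hm.le
  set a := √l
  set b := √(1 - l)
  have amgm := geom_mean_le_arith_mean2_weighted h0.le hm.le
    (div_pos (div_pos hq (hφ t)) ha).le (div_pos (div_pos hp (hφ s)) hb).le (by ring)
  have e1 : l * (q / gaussianPDFReal 0 1 t / a) + (1 - l) * (p / gaussianPDFReal 0 1 s / b) =
      a * (q / gaussianPDFReal 0 1 t) + b * (p / gaussianPDFReal 0 1 s) := by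
    nth_rw 1 [← hla]
    rw [← hlb]
    field_simp
  rw [e1] at amgm
  have e2 : gaussianPDFReal 0 1 (a * t - b * s) =
      gaussianPDFReal 0 1 t ^ l * gaussianPDFReal 0 1 s ^ (1 - l) * exp (a * b * (s * t)) := by
    have hc : 0 < (√(2 * π * (1 : ℝ≥0)))⁻¹ := by positivity
    simp only [gaussianPDFReal]
    rw [mul_rpow hc.le (exp_pos _).le, mul_rpow hc.le (exp_pos _).le, ← exp_mul, ← exp_mul]
    have : (√(2 * π * (1 : ℝ≥0)))⁻¹ = (√(2 * π * (1 : ℝ≥0)))⁻¹ ^ l *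
        (√(2 * π * (1 : ℝ≥0)))⁻¹ ^ (1 - l) := by
      rw [← rpow_add hc]; simp
    nth_rw 1 [this]
    rw [mul_mul_mul_comm, ← exp_add, mul_assoc _ (exp _), ← exp_add]
    congr 2
    simp only [NNReal.coe_one, sub_zero]
    linear_combination (-t ^ 2 / 2) * hla - (s ^ 2 / 2) * hlb
  calc p ^ (1 - l) * q ^ l * exp (a * b * (s * t))
      = a ^ l * b ^ (1 - l) * (((q / gaussianPDFReal 0 1 t / a) ^ l *
        (p / gaussianPDFReal 0 1 s / b) ^ (1 - l)) * gaussianPDFReal 0 1 (a * t - b * s)) := by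
        rw [e2, div_rpow (div_pos hq (hφ t)).le ha.le, div_rpow (div_pos hp (hφ s)).le hb.le,
          div_rpow hq.le (hφ t).le, div_rpow hp.le (hφ s).le]
        have := rpow_pos_of_pos ha l
        have := rpow_pos_of_pos hb (1 - l)
        have := rpow_pos_of_pos (hφ t) l
        have := rpow_pos_of_pos (hφ s) (1 - l)
        field_simp
    _ ≤ _ := by
        gcongr
        exact (hφ _).le

lemma lintegral_gaussianize_le {l : ℝ} (h0 : 0 < l) (h1 : l < 1) {f g : ℝ → ℝ≥0∞}
    (hf : Measurable f) (hg : Measurable g) (hf1 : ∫⁻ x, f x = 1) (hg1 : ∫⁻ x, g x = 1)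
    {h : ℝ → ℝ≥0∞} (hh : Measurable h) :
    ∫⁻ x, ∫⁻ y, h (x + y) * (f x ^ (1 - l) * g y ^ l *
        ENNReal.ofReal (exp (√l * √(1 - l) * (gaussianize f x * gaussianize g y)))) ≤
      ENNReal.ofReal (√l ^ l * √(1 - l) ^ (1 - l)) * ∫⁻ z, h z := by
  obtain ⟨A, hA, hA0, hAd, hAm⟩ := exists_set_hasDerivAt_gaussianize hf hf1
  obtain ⟨B, hB, hB0, hBd, hBm⟩ := exists_set_hasDerivAt_gaussianize hg hg1
  have hm : 0 < 1 - l := by linarith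
  have ha : 0 < √l := sqrt_pos.2 h0
  have hb : 0 < √(1 - l) := sqrt_pos.2 hm
  have hφ (x : ℝ) : 0 < gaussianPDFReal 0 1 x := gaussianPDFReal_pos _ _ _ one_ne_zero
  have hS : Measurable (gaussianize f) :=
    (measurable_gaussianize (P := Unit) (f := fun _ => f) (hf.comp measurable_snd)).comp
      (measurable_const.prodMk measurable_id : Measurable fun x : ℝ => ((), x))
  have hT : Measurable (gaussianize g) :=
    (measurable_gaussianize (P := Unit) (f := fun _ => g) (hg.comp measurable_snd)).comp
      (measurable_const.prodMk measurable_id : Measurable fun x : ℝ => ((), x))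
  set S := gaussianize f
  set T := gaussianize g
  set a := √l with ha_def
  set b := √(1 - l) with hb_def
  set C := a ^ l * b ^ (1 - l)
  have hC : 0 < C := by positivity
  let F : ℝ × ℝ → ℝ × ℝ := fun z => (z.1 + z.2, a * T z.2 - b * S z.1)
  let S' : ℝ → ℝ := fun x => (f x).toReal / gaussianPDFReal 0 1 (S x)
  let T' : ℝ → ℝ := fun x => (g x).toReal / gaussianPDFReal 0 1 (T x)
  have hS' (x : ℝ) : 0 ≤ S' x := div_nonneg ENNReal.toReal_nonneg (hφ _).le
  have hT' (x : ℝ) : 0 ≤ T' x := div_nonneg ENNReal.toReal_nonneg (hφ _).le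
  let F' : ℝ × ℝ → ℝ × ℝ →L[ℝ] ℝ × ℝ := fun z =>
    ((ContinuousLinearMap.fst ℝ ℝ ℝ) + (ContinuousLinearMap.snd ℝ ℝ ℝ)).prod
      ((a * T' z.2) • (ContinuousLinearMap.snd ℝ ℝ ℝ) -
        (b * S' z.1) • (ContinuousLinearMap.fst ℝ ℝ ℝ))
  have hF' : ∀ z ∈ A ×ˢ B, HasFDerivWithinAt F (F' z) (A ×ˢ B) z := by
    rintro ⟨x, y⟩ ⟨hx, hy⟩
    refine HasFDerivAt.hasFDerivWithinAt (HasFDerivAt.prodMk ?_ ?_)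
    · exact hasFDerivAt_fst.add hasFDerivAt_snd
    · have e1 : HasFDerivAt (fun z : ℝ × ℝ => a * T z.2)
          ((a * T' y) • (ContinuousLinearMap.snd ℝ ℝ ℝ)) (x, y) :=
        ((hBd y hy).2.2.const_mul a).comp_hasFDerivAt (h₂ := fun t => a * T t) (x, y)
          (hasFDerivAt_snd (𝕜 := ℝ) (E := ℝ) (F := ℝ))
      have e2 : HasFDerivAt (fun z : ℝ × ℝ => b * S z.1)
          ((b * S' x) • (ContinuousLinearMap.fst ℝ ℝ ℝ)) (x, y) :=
        ((hAd x hx).2.2.const_mul b).comp_hasFDerivAt (h₂ := fun t => b * S t) (x, y)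
          (hasFDerivAt_fst (𝕜 := ℝ) (E := ℝ) (F := ℝ))
      exact e1.sub e2
  have hinj : InjOn F (A ×ˢ B) := by
    have aux : ∀ x ∈ A, ∀ y ∈ B, ∀ x' ∈ A, ∀ y' ∈ B, F (x, y) = F (x', y') → ¬ x < x' := by
      intro x hx y hy x' hx' y' hy' hE hlt
      simp only [F, Prod.mk.injEq] at hE
      have hylt : y' < y := by linarith [hE.1]
      have i1 := mul_lt_mul_of_pos_left (hAm hx hx' hlt) hb
      have i2 := mul_lt_mul_of_pos_left (hBm hy' hy hylt) ha
      linarith [hE.2]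
    rintro ⟨x, y⟩ ⟨hx, hy⟩ ⟨x', y'⟩ ⟨hx', hy'⟩ hE
    have hxx : x = x' := le_antisymm (not_lt.1 (aux x' hx' y' hy' x hx y hy hE.symm))
      (not_lt.1 (aux x hx y hy x' hx' y' hy' hE))
    simp only [F, Prod.mk.injEq] at hE
    ext
    · exact hxx
    · linarith [hE.1]
  have hdet (z : ℝ × ℝ) : |(F' z).det| = a * T' z.2 + b * S' z.1 := by
    rw [det_sum_sub, abs_of_nonneg]
    exact add_nonneg (mul_nonneg ha.le (hT' _)) (mul_nonneg hb.le (hS' _))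
  let K : ℝ × ℝ → ℝ≥0∞ := fun z => h (z.1 + z.2) * (f z.1 ^ (1 - l) * g z.2 ^ l *
        ENNReal.ofReal (exp (a * b * (S z.1 * T z.2))))
  have hK : Measurable K := by fun_prop
  calc ∫⁻ x, ∫⁻ y, K (x, y) = ∫⁻ z, K z := (lintegral_prod _ hK.aemeasurable).symm
    _ = ∫⁻ z in A ×ˢ B, K z := by
        rw [← lintegral_indicator (hA.prod hB)]
        refine lintegral_congr_ae ?_
        have hA0' : ∀ᵐ z : ℝ × ℝ, z.1 ∉ A → f z.1 = 0 :=
          Measure.quasiMeasurePreserving_fst.ae hA0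
        have hB0' : ∀ᵐ z : ℝ × ℝ, z.2 ∉ B → g z.2 = 0 :=
          Measure.quasiMeasurePreserving_snd.ae hB0
        filter_upwards [hA0', hB0'] with z hzA hzB
        by_cases hz : z ∈ A ×ˢ B
        · simp [hz]
        · rw [indicator_of_notMem hz]
          rcases not_and_or.1 hz with h | h
          · simp [K, hzA h, hm]
          · simp [K, hzB h, h0]
    _ ≤ ∫⁻ z in A ×ˢ B, ENNReal.ofReal C * (ENNReal.ofReal |(F' z).det| *
          (h (F z).1 * gaussianPDF 0 1 (F z).2)) := by
        refine setLIntegral_mono' (hA.prod hB) ?_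
        rintro ⟨x, y⟩ ⟨hx, hy⟩
        obtain ⟨fx0, fxt, -⟩ := hAd x hx
        obtain ⟨gy0, gyt, -⟩ := hBd y hy
        have hp := ENNReal.toReal_pos fx0 fxt
        have hq := ENNReal.toReal_pos gy0 gyt
        have key := rpow_mul_rpow_mul_exp_le h0 h1 (s := S x) (t := T y) hp hq
        rw [hdet]
        simp only [K, F, gaussianPDF]
        rw [mul_left_comm _ (h _), mul_left_comm _ (h _), ← ENNReal.ofReal_mul' (hφ _).le,
          ← ENNReal.ofReal_mul hC.le]
        gcongr
        rw [← ENNReal.ofReal_toReal fxt, ← ENNReal.ofReal_toReal gyt,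
          ENNReal.ofReal_rpow_of_pos hp, ENNReal.ofReal_rpow_of_pos hq,
          ← ENNReal.ofReal_mul (by positivity), ← ENNReal.ofReal_mul (by positivity)]
        exact ENNReal.ofReal_le_ofReal key
    _ = ENNReal.ofReal C * ∫⁻ z in F '' (A ×ˢ B), h z.1 * gaussianPDF 0 1 z.2 := by
        rw [lintegral_const_mul' _ _ ENNReal.ofReal_ne_top]
        congr 1
        exact (lintegral_image_eq_lintegral_abs_det_fderiv_mul volume (hA.prod hB) hF' hinj
          (fun z : ℝ × ℝ => h z.1 * gaussianPDF 0 1 z.2)).symm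
    _ ≤ ENNReal.ofReal C * ∫⁻ z : ℝ × ℝ, h z.1 * gaussianPDF 0 1 z.2 := by
        gcongr
        exact Measure.restrict_le_self
    _ = ENNReal.ofReal C * ∫⁻ z, h z := by
        rw [Measure.volume_eq_prod, lintegral_prod_mul hh.aemeasurable
          (measurable_gaussianPDF 0 1).aemeasurable,
          lintegral_gaussianPDF_eq_one 0 one_ne_zero, mul_one]

/-- The marginal density of the first coordinate. -/
def headMarginal {d : ℕ} (f : (Fin (d + 1) → ℝ) → ℝ≥0∞) (t : ℝ) : ℝ≥0∞ :=
  ∫⁻ y : Fin d → ℝ, f (Fin.cons t y)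

/-- The conditional density of the remaining coordinates, given the first one. -/
def tailCond {d : ℕ} (f : (Fin (d + 1) → ℝ) → ℝ≥0∞) (t : ℝ) (y : Fin d → ℝ) : ℝ≥0∞ :=
  f (Fin.cons t y) / headMarginal f t

/-- The Knothe map, which transports the probability density `f` to the standard Gaussian one
coordinate at a time. -/
def knothe : (d : ℕ) → ((Fin d → ℝ) → ℝ≥0∞) → (Fin d → ℝ) → Fin d → ℝ
  | 0, _, x => x
  | d + 1, f, x => Fin.cons (gaussianize (headMarginal f) (x 0))
      (knothe d (tailCond f (x 0)) (Fin.tail x))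

lemma measurable_finCons {d : ℕ} :
    Measurable fun z : ℝ × (Fin d → ℝ) => (Fin.cons z.1 z.2 : Fin (d + 1) → ℝ) := by
  refine measurable_pi_lambda _ fun i => ?_
  refine Fin.cases ?_ (fun j => ?_) i
  · simpa using measurable_fst
  · simpa using (by fun_prop : Measurable fun z : ℝ × (Fin d → ℝ) => z.2 j)

lemma measurable_finTail {d : ℕ} : Measurable fun x : Fin (d + 1) → ℝ => Fin.tail x :=
  measurable_pi_lambda _ fun i => measurable_pi_apply i.succ

lemma lintegral_finCons {d : ℕ} {F : (Fin (d + 1) → ℝ) → ℝ≥0∞} (hF : Measurable F) :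
    ∫⁻ x, F x = ∫⁻ t : ℝ, ∫⁻ y : Fin d → ℝ, F (Fin.cons t y) := by
  have h := ((volume_preserving_piFinSuccAbove (fun _ : Fin (d + 1) => ℝ) 0).symm
    (MeasurableEquiv.piFinSuccAbove (fun _ : Fin (d + 1) => ℝ) 0)).lintegral_comp hF
  rw [← h]
  have e : ∀ z : ℝ × (Fin d → ℝ),
      (MeasurableEquiv.piFinSuccAbove (fun _ : Fin (d + 1) => ℝ) 0).symm z = Fin.cons z.1 z.2 := by
    intro z
    rw [MeasurableEquiv.symm_apply_eq]
    ext <;> simp [MeasurableEquiv.piFinSuccAbove, Fin.insertNthEquiv]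
  simp only [e]
  exact lintegral_prod _ (hF.comp measurable_finCons).aemeasurable

section Measurability

variable {P : Type*} [MeasurableSpace P] {d : ℕ}

lemma measurable_headMarginal {f : P → (Fin (d + 1) → ℝ) → ℝ≥0∞}
    (hf : Measurable (Function.uncurry f)) :
    Measurable fun z : P × ℝ => headMarginal (f z.1) z.2 :=
  Measurable.lintegral_prod_right' (f := fun q : (P × ℝ) × (Fin d → ℝ) =>
    f q.1.1 (Fin.cons q.1.2 q.2)) (hf.comp ((measurable_fst.comp measurable_fst).prodMk
      (measurable_finCons.comp ((measurable_snd.comp measurable_fst).prodMk measurable_snd))))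

lemma measurable_tailCond {f : P → (Fin (d + 1) → ℝ) → ℝ≥0∞}
    (hf : Measurable (Function.uncurry f)) :
    Measurable (Function.uncurry fun z : P × ℝ => tailCond (f z.1) z.2) :=
  Measurable.div (hf.comp ((measurable_fst.comp measurable_fst).prodMk
      (measurable_finCons.comp ((measurable_snd.comp measurable_fst).prodMk measurable_snd))))
    ((measurable_headMarginal hf).comp measurable_fst)

end Measurability

lemma measurable_knothe_param (d : ℕ) {P : Type*} [MeasurableSpace P]
    {f : P → (Fin d → ℝ) → ℝ≥0∞} (hf : Measurable (Function.uncurry f)) :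
    Measurable fun z : P × (Fin d → ℝ) => knothe d (f z.1) z.2 := by
  induction d generalizing P with
  | zero => exact measurable_snd
  | succ d ih =>
    refine measurable_finCons.comp (Measurable.prodMk ?_ ?_)
    · exact (measurable_gaussianize (f := fun p => headMarginal (f p))
        (measurable_headMarginal hf)).comp
        (measurable_fst.prodMk ((measurable_pi_apply 0).comp measurable_snd))
    · exact (ih (measurable_tailCond hf)).comp
        ((measurable_fst.prodMk ((measurable_pi_apply 0).comp measurable_snd)).prodMk
          (measurable_finTail.comp measurable_snd))

lemma measurable_knothe {d : ℕ} {f : (Fin d → ℝ) → ℝ≥0∞} (hf : Measurable f) :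
    Measurable (knothe d f) :=
  (measurable_knothe_param d (P := Unit) (f := fun _ => f) (hf.comp measurable_snd)).comp
    (measurable_const.prodMk measurable_id : Measurable fun x : Fin d → ℝ => ((), x))

lemma measurable_headMarginal' {d : ℕ} {f : (Fin (d + 1) → ℝ) → ℝ≥0∞} (hf : Measurable f) :
    Measurable (headMarginal f) :=
  Measurable.lintegral_prod_right' (f := fun z : ℝ × (Fin d → ℝ) => f (Fin.cons z.1 z.2))
    (hf.comp measurable_finCons)

lemma measurable_tailCond' {d : ℕ} {f : (Fin (d + 1) → ℝ) → ℝ≥0∞} (hf : Measurable f) :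
    Measurable (Function.uncurry (tailCond f)) :=
  (hf.comp measurable_finCons).div ((measurable_headMarginal' hf).comp measurable_fst)

lemma lintegral_headMarginal {d : ℕ} {f : (Fin (d + 1) → ℝ) → ℝ≥0∞} (hf : Measurable f) :
    ∫⁻ t, headMarginal f t = ∫⁻ x, f x := (lintegral_finCons hf).symm

lemma ae_disintegration {d : ℕ} {f : (Fin (d + 1) → ℝ) → ℝ≥0∞} (hf : Measurable f)
    (hf1 : ∫⁻ x, f x = 1) :
    ∀ᵐ t, (headMarginal f t = 0 ∨ ∫⁻ y, tailCond f t y = 1) ∧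
      ∀ᵐ y, f (Fin.cons t y) = headMarginal f t * tailCond f t y := by
  have hm : ∀ᵐ t, headMarginal f t < ∞ := ae_lt_top (measurable_headMarginal' hf) (by
    rw [lintegral_headMarginal hf, hf1]; exact ENNReal.one_ne_top)
  filter_upwards [hm] with t ht
  have hsec : Measurable fun y : Fin d → ℝ => f (Fin.cons t y) :=
    (hf.comp measurable_finCons).comp (measurable_const.prodMk measurable_id)
  by_cases h0 : headMarginal f t = 0
  · refine ⟨Or.inl h0, ?_⟩
    filter_upwards [(lintegral_eq_zero_iff hsec).1 h0] with y hy
    rw [h0, zero_mul]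
    exact hy
  · refine ⟨Or.inr ?_, .of_forall fun y => (ENNReal.mul_div_cancel h0 ht.ne).symm⟩
    simp only [tailCond, div_eq_mul_inv]
    rw [lintegral_mul_const _ hsec]
    exact ENNReal.mul_inv_cancel h0 ht.ne

lemma lintegral_comp_knothe_le {d : ℕ} {f : (Fin d → ℝ) → ℝ≥0∞} (hf : Measurable f)
    (hf1 : ∫⁻ x, f x = 1) (i : Fin d) {u : ℝ → ℝ≥0∞} (hu : Measurable u) :
    ∫⁻ x, u (knothe d f x i) * f x ≤ ∫⁻ x, u x * gaussianPDF 0 1 x := by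
  induction d with
  | zero => exact i.elim0
  | succ d ih =>
    have hS (i : Fin (d + 1)) : Measurable fun x => u (knothe (d + 1) f x i) :=
      hu.comp ((measurable_pi_apply i).comp (measurable_knothe hf))
    rw [lintegral_finCons (F := fun x => u (knothe (d + 1) f x i) * f x) ((hS i).mul hf)]
    have hsec (t : ℝ) : Measurable fun y : Fin d → ℝ => f (Fin.cons t y) :=
      (hf.comp measurable_finCons).comp (measurable_const.prodMk measurable_id)
    refine Fin.cases ?_ (fun j => ?_) i
    · simp only [knothe, Fin.cons_zero]
      simp_rw [lintegral_const_mul _ (hsec _)]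
      exact lintegral_comp_gaussianize_le (measurable_headMarginal' hf)
        ((lintegral_headMarginal hf).trans hf1) u
    · simp only [knothe, Fin.cons_zero, Fin.cons_succ, Fin.tail_cons]
      calc ∫⁻ t, ∫⁻ y, u (knothe d (tailCond f t) y j) * f (Fin.cons t y)
          ≤ ∫⁻ t, headMarginal f t * ∫⁻ x, u x * gaussianPDF 0 1 x := by
            refine lintegral_mono_ae ?_
            filter_upwards [ae_disintegration hf hf1] with t ⟨ht, hty⟩
            have hc : Measurable (tailCond f t) := (measurable_tailCond' hf).of_uncurry_left
            have e : ∫⁻ y, u (knothe d (tailCond f t) y j) * f (Fin.cons t y) =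
                headMarginal f t * ∫⁻ y, u (knothe d (tailCond f t) y j) * tailCond f t y := by
              have hm : Measurable fun y => u (knothe d (tailCond f t) y j) * tailCond f t y :=
                (hu.comp ((measurable_pi_apply j).comp (measurable_knothe hc))).mul hc
              rw [← lintegral_const_mul _ hm]
              refine lintegral_congr_ae ?_
              filter_upwards [hty] with y hy
              rw [hy, mul_left_comm]
            rw [e]
            rcases ht with ht | ht
            · simp [ht]
            · gcongr
              exact ih hc ht j
        _ = ∫⁻ x, u x * gaussianPDF 0 1 x := by
            rw [lintegral_mul_const _ (measurable_headMarginal' hf), lintegral_headMarginal hf, hf1,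
              one_mul]

/-- A transport form of the inequality for `d`-dimensional densities. The weight is the exponential
of a multiple of the inner product of the two Knothe maps. -/
lemma lintegral_knothe_le {l : ℝ} (h0 : 0 < l) (h1 : l < 1) {d : ℕ}
    {f g : (Fin d → ℝ) → ℝ≥0∞} (hf : Measurable f) (hg : Measurable g) (hf1 : ∫⁻ x, f x = 1)
    (hg1 : ∫⁻ x, g x = 1) {h : (Fin d → ℝ) → ℝ≥0∞} (hh : Measurable h) :
    ∫⁻ x, ∫⁻ y, h (x + y) * (f x ^ (1 - l) * g y ^ l *
        ENNReal.ofReal (exp (√l * √(1 - l) * ∑ i, knothe d f x i * knothe d g y i))) ≤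
      ENNReal.ofReal (√l ^ l * √(1 - l) ^ (1 - l)) ^ d * ∫⁻ z, h z := by
  induction d with
  | zero =>
    have e (F : (Fin 0 → ℝ) → ℝ≥0∞) : ∫⁻ x, F x = F 0 := by
      rw [volume_pi, Measure.pi_of_empty _ (0 : Fin 0 → ℝ)]
      simp
    rw [e] at hf1 hg1
    rw [e, e, e, hf1, hg1]
    simp
  | succ d ih =>
    have hl : 0 < 1 - l := by linarith
    set c := √l * √(1 - l)
    set C := ENNReal.ofReal (√l ^ l * √(1 - l) ^ (1 - l))
    let K : (Fin (d + 1) → ℝ) → (Fin (d + 1) → ℝ) → ℝ≥0∞ := fun x y =>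
      h (x + y) * (f x ^ (1 - l) * g y ^ l *
        ENNReal.ofReal (exp (c * ∑ i, knothe (d + 1) f x i * knothe (d + 1) g y i)))
    have hK : Measurable (Function.uncurry K) := by
      have := measurable_knothe hf
      have := measurable_knothe hg
      unfold K Function.uncurry
      fun_prop
    let W (t s : ℝ) : ℝ≥0∞ := ENNReal.ofReal
      (exp (c * (gaussianize (headMarginal f) t * gaussianize (headMarginal g) s)))
    let H (z : ℝ) : ℝ≥0∞ := ∫⁻ y : Fin d → ℝ, h (Fin.cons z y)
    have hH : Measurable H := Measurable.lintegral_prod_right'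
      (f := fun z : ℝ × (Fin d → ℝ) => h (Fin.cons z.1 z.2)) (hh.comp measurable_finCons)
    have hcons (t s : ℝ) (x y : Fin d → ℝ) : K (Fin.cons t x) (Fin.cons s y) =
        W t s * (h (Fin.cons (t + s) (x + y)) * (f (Fin.cons t x) ^ (1 - l) *
          g (Fin.cons s y) ^ l * ENNReal.ofReal (exp (c * ∑ i, knothe d (tailCond f t) x i *
            knothe d (tailCond g s) y i)))) := by
      have e : (Fin.cons t x + Fin.cons s y : Fin (d + 1) → ℝ) = Fin.cons (t + s) (x + y) := by
        ext i
        refine Fin.cases ?_ (fun j => ?_) i <;> simp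
      simp only [K, W, e, Fin.sum_univ_succ, knothe, Fin.cons_zero, Fin.cons_succ, Fin.tail_cons,
        mul_add, exp_add]
      rw [ENNReal.ofReal_mul (exp_pos _).le]
      ring
    have hmeasK : Measurable fun q : (ℝ × (Fin d → ℝ)) × (ℝ × (Fin d → ℝ)) =>
        K (Fin.cons q.1.1 q.1.2) (Fin.cons q.2.1 q.2.2) :=
      hK.comp ((measurable_finCons.comp measurable_fst).prodMk
        (measurable_finCons.comp measurable_snd))
    have step (t s : ℝ)
        (ht : headMarginal f t = 0 ∨ ∫⁻ y, tailCond f t y = 1)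
        (hty : ∀ᵐ y, f (Fin.cons t y) = headMarginal f t * tailCond f t y)
        (hs : headMarginal g s = 0 ∨ ∫⁻ y, tailCond g s y = 1)
        (hsy : ∀ᵐ y, g (Fin.cons s y) = headMarginal g s * tailCond g s y) :
        ∫⁻ x, ∫⁻ y, K (Fin.cons t x) (Fin.cons s y) ≤ C ^ d * (H (t + s) *
          (headMarginal f t ^ (1 - l) * headMarginal g s ^ l * W t s)) := by
      have hcf : Measurable (tailCond f t) := (measurable_tailCond' hf).of_uncurry_left
      have hcg : Measurable (tailCond g s) := (measurable_tailCond' hg).of_uncurry_left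
      have hSf := measurable_knothe hcf
      have hSg := measurable_knothe hcg
      have hhz : Measurable fun z : Fin d → ℝ => h (Fin.cons (t + s) z) :=
        (hh.comp measurable_finCons).comp (measurable_const.prodMk measurable_id)
      let L (x y : Fin d → ℝ) : ℝ≥0∞ := h (Fin.cons (t + s) (x + y)) *
        (tailCond f t x ^ (1 - l) * tailCond g s y ^ l * ENNReal.ofReal
          (exp (c * ∑ i, knothe d (tailCond f t) x i * knothe d (tailCond g s) y i)))
      have hL : Measurable (Function.uncurry L) := by
        have : Measurable fun z : (Fin d → ℝ) × (Fin d → ℝ) => h (Fin.cons (t + s) (z.1 + z.2)) :=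
          hhz.comp (measurable_fst.add measurable_snd)
        unfold L Function.uncurry
        fun_prop
      have e : ∫⁻ x, ∫⁻ y, K (Fin.cons t x) (Fin.cons s y) =
          (headMarginal f t ^ (1 - l) * headMarginal g s ^ l * W t s) * ∫⁻ x, ∫⁻ y, L x y := by
        have hL' : Measurable fun x => ∫⁻ y, L x y := hL.lintegral_prod_right'
        rw [← lintegral_const_mul _ hL']
        refine lintegral_congr_ae ?_
        filter_upwards [hty] with x hx
        have hLx : Measurable (L x) := hL.of_uncurry_left
        rw [← lintegral_const_mul _ hLx]
        refine lintegral_congr_ae ?_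
        filter_upwards [hsy] with y hy
        rw [hcons, hx, hy, ENNReal.mul_rpow_of_nonneg _ _ hl.le,
          ENNReal.mul_rpow_of_nonneg _ _ h0.le]
        ring
      rw [e]
      rcases ht with ht | ht
      · simp [ht, hl]
      rcases hs with hs | hs
      · simp [hs, h0]
      calc (headMarginal f t ^ (1 - l) * headMarginal g s ^ l * W t s) * ∫⁻ x, ∫⁻ y, L x y
          ≤ (headMarginal f t ^ (1 - l) * headMarginal g s ^ l * W t s) *
            (C ^ d * H (t + s)) := by
            gcongr
            exact ih hcf hcg ht hs hhz
        _ = _ := by ring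
    calc ∫⁻ x, ∫⁻ y, K x y
        = ∫⁻ t, ∫⁻ x : Fin d → ℝ, ∫⁻ s, ∫⁻ y : Fin d → ℝ, K (Fin.cons t x) (Fin.cons s y) := by
          have hK' : Measurable fun x => ∫⁻ y, K x y := hK.lintegral_prod_right'
          rw [lintegral_finCons hK']
          refine lintegral_congr fun t => lintegral_congr fun x => ?_
          exact lintegral_finCons hK.of_uncurry_left
      _ = ∫⁻ t, ∫⁻ s, ∫⁻ x : Fin d → ℝ, ∫⁻ y : Fin d → ℝ, K (Fin.cons t x) (Fin.cons s y) := by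
          refine lintegral_congr fun t => lintegral_lintegral_swap ?_
          refine Measurable.aemeasurable ?_
          exact Measurable.lintegral_prod_right'
            (f := fun q : ((Fin d → ℝ) × ℝ) × (Fin d → ℝ) =>
              K (Fin.cons t q.1.1) (Fin.cons q.1.2 q.2))
            (hmeasK.comp ((measurable_const.prodMk (measurable_fst.comp measurable_fst)).prodMk
              ((measurable_snd.comp measurable_fst).prodMk measurable_snd)))
      _ ≤ ∫⁻ t, ∫⁻ s, C ^ d * (H (t + s) *
          (headMarginal f t ^ (1 - l) * headMarginal g s ^ l * W t s)) := by
          refine lintegral_mono_ae ?_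
          filter_upwards [ae_disintegration hf hf1] with t ⟨ht, hty⟩
          refine lintegral_mono_ae ?_
          filter_upwards [ae_disintegration hg hg1] with s ⟨hs, hsy⟩
          exact step t s ht hty hs hsy
      _ = C ^ d * ∫⁻ t, ∫⁻ s, H (t + s) *
          (headMarginal f t ^ (1 - l) * headMarginal g s ^ l * W t s) := by
          have hC : C ^ d ≠ ∞ := ENNReal.pow_ne_top ENNReal.ofReal_ne_top
          simp_rw [lintegral_const_mul' _ _ hC]
      _ ≤ C ^ d * (C * ∫⁻ z, H z) := by
          gcongr
          exact lintegral_gaussianize_le h0 h1 (measurable_headMarginal' hf)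
            (measurable_headMarginal' hg) ((lintegral_headMarginal hf).trans hf1)
            ((lintegral_headMarginal hg).trans hg1) hH
      _ = C ^ (d + 1) * ∫⁻ z, h z := by
          rw [lintegral_finCons hh, pow_succ, mul_assoc]

/-- The measure with density `f` with respect to the Lebesgue measure. -/
def densityMeasure {d : ℕ} (f : (Fin d → ℝ) → ℝ) : Measure (Fin d → ℝ) :=
  volume.withDensity fun x => ENNReal.ofReal (f x)

lemma IsDensity.lintegral_ofReal {d : ℕ} {f : (Fin d → ℝ) → ℝ} (hf : IsDensity d f) :
    ∫⁻ x, ENNReal.ofReal (f x) = 1 := by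
  have hi : Integrable f := by
    by_contra h
    exact zero_ne_one ((integral_undef h).symm.trans hf.2.2)
  rw [← ofReal_integral_eq_lintegral_ofReal hi (.of_forall hf.2.1), hf.2.2, ENNReal.ofReal_one]

lemma IsDensity.isProbabilityMeasure {d : ℕ} {f : (Fin d → ℝ) → ℝ} (hf : IsDensity d f) :
    IsProbabilityMeasure (densityMeasure f) :=
  ⟨by rw [densityMeasure, withDensity_apply _ MeasurableSet.univ, Measure.restrict_univ,
    hf.lintegral_ofReal]⟩

lemma ae_densityMeasure_pos {d : ℕ} {f : (Fin d → ℝ) → ℝ} (hf : Measurable f) :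
    ∀ᵐ x ∂densityMeasure f, 0 < f x := by
  rw [densityMeasure, ae_withDensity_iff hf.ennreal_ofReal]
  refine .of_forall fun x hx => ?_
  simpa using hx

lemma integrable_densityMeasure_log {d : ℕ} {f : (Fin d → ℝ) → ℝ} (hf : Measurable f)
    (hf0 : ∀ x, 0 ≤ f x) (hent : Integrable fun x => f x * log (f x)) :
    Integrable (fun x => log (f x)) (densityMeasure f) := by
  rw [densityMeasure, integrable_withDensity_iff_integrable_smul' hf.ennreal_ofReal (by simp)]
  simpa [hf0] using hent

lemma integral_densityMeasure_log {d : ℕ} {f : (Fin d → ℝ) → ℝ} (hf : Measurable f)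
    (hf0 : ∀ x, 0 ≤ f x) :
    ∫ x, log (f x) ∂densityMeasure f = -shannonH d f := by
  rw [densityMeasure, integral_withDensity_eq_integral_toReal_smul hf.ennreal_ofReal (by simp)]
  simp [hf0, shannonH]

lemma map_knothe_densityMeasure {d : ℕ} {f : (Fin d → ℝ) → ℝ} (hf : IsDensity d f) (i : Fin d) :
    (densityMeasure f).map (fun x => knothe d (fun x => ENNReal.ofReal (f x)) x i) =
      gaussianReal 0 1 := by
  have hfm : Measurable fun x => ENNReal.ofReal (f x) := hf.1.ennreal_ofReal
  have hS : Measurable fun x => knothe d (fun x => ENNReal.ofReal (f x)) x i :=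
    (measurable_pi_apply i).comp (measurable_knothe hfm)
  have := hf.isProbabilityMeasure
  have := Measure.isProbabilityMeasure_map (μ := densityMeasure f) hS.aemeasurable
  refine Measure.eq_of_le_of_isProbabilityMeasure (Measure.le_iff.2 fun s hs => ?_)
  have hu : Measurable (s.indicator (1 : ℝ → ℝ≥0∞)) := measurable_one.indicator hs
  have huS : Measurable fun x =>
      s.indicator (1 : ℝ → ℝ≥0∞) (knothe d (fun x => ENNReal.ofReal (f x)) x i) := hu.comp hS
  have key := lintegral_comp_knothe_le hfm hf.lintegral_ofReal i hu
  rw [← lintegral_indicator_one hs, ← lintegral_indicator_one hs, lintegral_map hu hS,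
    densityMeasure, lintegral_withDensity_eq_lintegral_mul _ hfm huS,
    gaussianReal_of_var_ne_zero 0 one_ne_zero,
    lintegral_withDensity_eq_lintegral_mul _ (measurable_gaussianPDF 0 1) hu]
  simpa only [Pi.mul_apply, mul_comm] using key

lemma integrable_knothe {d : ℕ} {f : (Fin d → ℝ) → ℝ} (hf : IsDensity d f) (i : Fin d) :
    Integrable (fun x => knothe d (fun x => ENNReal.ofReal (f x)) x i) (densityMeasure f) := by
  have hS : Measurable fun x => knothe d (fun x => ENNReal.ofReal (f x)) x i :=
    (measurable_pi_apply i).comp (measurable_knothe hf.1.ennreal_ofReal)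
  have h : Integrable id (gaussianReal 0 1) := memLp_one_iff_integrable.1 (memLp_id_gaussianReal 1)
  rw [← map_knothe_densityMeasure hf i] at h
  exact h.comp_measurable hS

lemma integral_knothe {d : ℕ} {f : (Fin d → ℝ) → ℝ} (hf : IsDensity d f) (i : Fin d) :
    ∫ x, knothe d (fun x => ENNReal.ofReal (f x)) x i ∂densityMeasure f = 0 := by
  have hS : Measurable fun x => knothe d (fun x => ENNReal.ofReal (f x)) x i :=
    (measurable_pi_apply i).comp (measurable_knothe hf.1.ennreal_ofReal)
  have h : ∫ x, x ∂gaussianReal 0 1 = 0 := integral_id_gaussianReal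
  rwa [← map_knothe_densityMeasure hf i,
    integral_map (f := fun x : ℝ => x) hS.aemeasurable
      measurable_id.aestronglyMeasurable] at h

lemma measurable_conv {d : ℕ} {f g : (Fin d → ℝ) → ℝ} (hf : Measurable f) (hg : Measurable g) :
    Measurable (conv d f g) := by
  have h : Measurable fun z : (Fin d → ℝ) × (Fin d → ℝ) => f z.2 * g (z.1 - z.2) := by fun_prop
  exact h.stronglyMeasurable.integral_prod_right'.measurable

lemma conv_nonneg {d : ℕ} {f g : (Fin d → ℝ) → ℝ} (hf : ∀ x, 0 ≤ f x) (hg : ∀ x, 0 ≤ g x)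
    (z : Fin d → ℝ) : 0 ≤ conv d f g z :=
  integral_nonneg fun x => mul_nonneg (hf x) (hg _)

lemma densityMeasure_conv {d : ℕ} {f g : (Fin d → ℝ) → ℝ} (hf : IsDensity d f)
    (hg : IsDensity d g) :
    (densityMeasure f).conv (densityMeasure g) = densityMeasure (conv d f g) := by
  have := hf.isProbabilityMeasure
  have := hg.isProbabilityMeasure
  have hfm := hf.1.ennreal_ofReal
  have hgm := hg.1.ennreal_ofReal
  have h := conv_withDensity_eq_lconvolution (μ := volume) hfm hgm
  set k : (Fin d → ℝ) → ℝ≥0∞ :=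
    (fun x => ENNReal.ofReal (f x)) ⋆ₗ[volume] fun x => ENNReal.ofReal (g x) with hk
  have hkm : Measurable k := measurable_lconvolution _ hfm hgm
  have hconv : ∀ z, conv d f g z = (k z).toReal := by
    intro z
    have hm : Measurable fun x => f x * g (z - x) := by
      have := hf.1
      have := hg.1
      fun_prop
    rw [conv, integral_eq_lintegral_of_nonneg_ae
      (.of_forall fun x => mul_nonneg (hf.2.1 x) (hg.2.1 _)) hm.aestronglyMeasurable, hk,
      lconvolution_def]
    congr 1
    refine lintegral_congr fun x => ?_
    rw [ENNReal.ofReal_mul (hf.2.1 x), neg_add_eq_sub]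
  have hkfin : ∫⁻ z, k z ≠ ∞ := by
    have h1 : volume.withDensity k univ = ∫⁻ z, k z := by
      rw [withDensity_apply _ MeasurableSet.univ, Measure.restrict_univ]
    rw [← h1, ← h]
    change ((densityMeasure f).conv (densityMeasure g)) univ ≠ ∞
    exact measure_ne_top _ _
  refine h.trans (withDensity_congr_ae ?_)
  filter_upwards [ae_lt_top hkm hkfin] with z hz
  rw [hconv, ENNReal.ofReal_toReal hz.ne]

lemma lintegral_ratio_le {l : ℝ} (h0 : 0 < l) (h1 : l < 1) {d : ℕ} {f g h : (Fin d → ℝ) → ℝ}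
    (hf : IsDensity d f) (hg : IsDensity d g) (hh : Measurable h) :
    ∫⁻ z, ENNReal.ofReal (h (z.1 + z.2)) * ENNReal.ofReal (f z.1 ^ (-l) * g z.2 ^ (-(1 - l)) *
        exp (√l * √(1 - l) * ∑ i, knothe d (fun x => ENNReal.ofReal (f x)) z.1 i *
          knothe d (fun x => ENNReal.ofReal (g x)) z.2 i))
        ∂(densityMeasure f).prod (densityMeasure g) ≤
      ENNReal.ofReal (√l ^ l * √(1 - l) ^ (1 - l)) ^ d * ∫⁻ z, ENNReal.ofReal (h z) := by
  have hl : 0 < 1 - l := by linarith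
  have hfm := hf.1
  have hgm := hg.1
  have hS := measurable_knothe hfm.ennreal_ofReal
  have hT := measurable_knothe hgm.ennreal_ofReal
  have := hf.isProbabilityMeasure
  have := hg.isProbabilityMeasure
  refine le_trans ?_ (lintegral_knothe_le h0 h1 hfm.ennreal_ofReal hgm.ennreal_ofReal
    hf.lintegral_ofReal hg.lintegral_ofReal hh.ennreal_ofReal)
  rw [densityMeasure, densityMeasure, prod_withDensity hfm.ennreal_ofReal hgm.ennreal_ofReal,
    lintegral_withDensity_eq_lintegral_mul _ (by fun_prop) (by fun_prop),
    lintegral_prod _ (by fun_prop)]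
  refine lintegral_mono fun x => lintegral_mono fun y => ?_
  simp only [Pi.mul_apply]
  rcases (hf.2.1 x).eq_or_lt with hx | hx
  · simp [← hx]
  rcases (hg.2.1 y).eq_or_lt with hy | hy
  · simp [← hy]
  refine le_of_eq ?_
  rw [ENNReal.ofReal_rpow_of_pos hx, ENNReal.ofReal_rpow_of_pos hy, mul_left_comm]
  congr 1
  rw [← ENNReal.ofReal_mul hx.le, ← ENNReal.ofReal_mul (by positivity),
    ← ENNReal.ofReal_mul (by positivity), ← ENNReal.ofReal_mul (by positivity)]
  congr 1
  have e1 : f x ^ (1 - l) = f x * f x ^ (-l) := by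
    rw [sub_eq_add_neg, rpow_add hx, rpow_one]
  have e2 : g y ^ l = g y * g y ^ (-(1 - l)) := by
    nth_rw 2 [← rpow_one (g y)]
    rw [← rpow_add hy]
    congr 1
    ring
  rw [e1, e2]
  ring

/-- The entropy power inequality in linearized form. -/
lemma shannonH_conv_ge {l : ℝ} (h0 : 0 < l) (h1 : l < 1) {d : ℕ} {f g : (Fin d → ℝ) → ℝ}
    (hf : IsDensity d f) (hg : IsDensity d g)
    (hfent : Integrable (fun x : Fin d → ℝ => f x * log (f x)))
    (hgent : Integrable (fun x : Fin d → ℝ => g x * log (g x)))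
    (hhent : Integrable (fun x : Fin d → ℝ => conv d f g x * log (conv d f g x))) :
    l * shannonH d f + (1 - l) * shannonH d g - d * log (√l ^ l * √(1 - l) ^ (1 - l)) ≤
      shannonH d (conv d f g) := by
  have hm : 0 < 1 - l := by linarith
  have ha : 0 < √l := sqrt_pos.2 h0
  have hb : 0 < √(1 - l) := sqrt_pos.2 hm
  have := hf.isProbabilityMeasure
  have := hg.isProbabilityMeasure
  have hfm := hf.1
  have hgm := hg.1
  have hkm := measurable_conv hf.1 hg.1
  have hk0 := conv_nonneg hf.2.1 hg.2.1
  have hlaw : ((densityMeasure f).prod (densityMeasure g)).map (fun z => z.1 + z.2) =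
      densityMeasure (conv d f g) := densityMeasure_conv hf hg
  have hadd : Measurable fun z : (Fin d → ℝ) × (Fin d → ℝ) => z.1 + z.2 := by fun_prop
  set ρ := (densityMeasure f).prod (densityMeasure g) with hρ
  have hk1 : ∫⁻ z, ENNReal.ofReal (conv d f g z) = 1 := by
    have : densityMeasure (conv d f g) univ = 1 := by
      rw [← hlaw, Measure.map_apply hadd MeasurableSet.univ]
      simp
    rwa [densityMeasure, withDensity_apply _ MeasurableSet.univ, Measure.restrict_univ] at this
  set S := knothe d (fun x => ENNReal.ofReal (f x))
  set T := knothe d (fun x => ENNReal.ofReal (g x))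
  have hS : Measurable S := measurable_knothe hfm.ennreal_ofReal
  have hT : Measurable T := measurable_knothe hgm.ennreal_ofReal
  set k := conv d f g
  -- integrability and integrals of the logarithms of the four factors
  have ik : Integrable (fun z : (Fin d → ℝ) × (Fin d → ℝ) => log (k (z.1 + z.2))) ρ := by
    have := integrable_densityMeasure_log hkm hk0 hhent
    rw [← hlaw] at this
    exact this.comp_measurable hadd
  have hlk : Measurable fun x => log (k x) := measurable_log.comp hkm
  have vk : ∫ z, log (k (z.1 + z.2)) ∂ρ = -shannonH d k := by
    rw [← integral_densityMeasure_log hkm hk0, ← hlaw, integral_map hadd.aemeasurable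
      hlk.aestronglyMeasurable]
  have jf := (integrable_densityMeasure_log hfm hf.2.1 hfent).comp_fst (densityMeasure g)
  have vf : ∫ z, log (f z.1) ∂ρ = -shannonH d f := by
    rw [hρ, integral_fun_fst (fun x => log (f x)), integral_densityMeasure_log hfm hf.2.1]
    simp
  have jg := (integrable_densityMeasure_log hgm hg.2.1 hgent).comp_snd (densityMeasure f)
  have vg : ∫ z, log (g z.2) ∂ρ = -shannonH d g := by
    rw [hρ, integral_fun_snd (fun x => log (g x)), integral_densityMeasure_log hgm hg.2.1]
    simp
  have jW (i : Fin d) : Integrable (fun z => S z.1 i * T z.2 i) ρ :=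
    (integrable_knothe hf i).mul_prod (integrable_knothe hg i)
  have iW : Integrable (fun z => ∑ i, S z.1 i * T z.2 i) ρ :=
    integrable_finsetSum _ fun i _ => jW i
  have vW : ∫ z, ∑ i, S z.1 i * T z.2 i ∂ρ = 0 := by
    rw [integral_finsetSum _ fun i _ => jW i]
    refine Finset.sum_eq_zero fun i _ => ?_
    rw [hρ, integral_prod_mul (fun x => S x i) (fun y => T y i), integral_knothe hf i, zero_mul]
  -- the ratio and the bound on its mean
  set c := √l * √(1 - l)
  set C := √l ^ l * √(1 - l) ^ (1 - l)
  have hC : 0 < C ^ d := by positivity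
  let R : (Fin d → ℝ) × (Fin d → ℝ) → ℝ := fun z => k (z.1 + z.2) *
    (f z.1 ^ (-l) * g z.2 ^ (-(1 - l)) * exp (c * ∑ i, S z.1 i * T z.2 i))
  have hRm : Measurable R := by fun_prop
  have hR0 (z) : 0 ≤ R z := mul_nonneg (hk0 _) (mul_nonneg (mul_nonneg
    (rpow_nonneg (hf.2.1 _) _) (rpow_nonneg (hg.2.1 _) _)) (exp_pos _).le)
  have hRle : ∫⁻ z, ENNReal.ofReal (R z) ∂ρ ≤ ENNReal.ofReal (C ^ d) := by
    have := lintegral_ratio_le h0 h1 hf hg hkm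
    rw [hk1, mul_one, ← ENNReal.ofReal_pow (by positivity)] at this
    refine le_trans (le_of_eq ?_) this
    exact lintegral_congr fun z => ENNReal.ofReal_mul (hk0 _)
  have hRi : Integrable R ρ :=
    ⟨hRm.aestronglyMeasurable, (hasFiniteIntegral_iff_ofReal (.of_forall hR0)).2
      (hRle.trans_lt ENNReal.ofReal_lt_top)⟩
  have hRint : ∫ z, R z ∂ρ ≤ C ^ d := by
    rw [← ENNReal.ofReal_le_ofReal_iff hC.le,
      ofReal_integral_eq_lintegral_ofReal hRi (.of_forall hR0)]
    exact hRle
  -- positivity of the factors almost everywhere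
  have pf : ∀ᵐ z ∂ρ, 0 < f z.1 :=
    Measure.quasiMeasurePreserving_fst.ae (ae_densityMeasure_pos hfm)
  have pg : ∀ᵐ z ∂ρ, 0 < g z.2 :=
    Measure.quasiMeasurePreserving_snd.ae (ae_densityMeasure_pos hgm)
  have pk : ∀ᵐ z ∂ρ, 0 < k (z.1 + z.2) := by
    have := ae_densityMeasure_pos hkm
    rw [← hlaw] at this
    exact ae_of_ae_map hadd.aemeasurable this
  have hle : ∀ᵐ z ∂ρ, log (k (z.1 + z.2)) - l * log (f z.1) - (1 - l) * log (g z.2) +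
      c * ∑ i, S z.1 i * T z.2 i ≤ R z / C ^ d + (log (C ^ d) - 1) := by
    filter_upwards [pf, pg, pk] with z zf zg zk
    have hRpos : 0 < R z := by positivity
    have e := log_le_sub_one_of_pos (div_pos hRpos hC)
    rw [log_div hRpos.ne' hC.ne'] at e
    have e2 : log (R z) = log (k (z.1 + z.2)) - l * log (f z.1) - (1 - l) * log (g z.2) +
        c * ∑ i, S z.1 i * T z.2 i := by
      simp only [R]
      rw [log_mul zk.ne' (by positivity), log_mul (by positivity) (exp_pos _).ne',
        log_mul (by positivity) (by positivity), log_rpow zf, log_rpow zg, log_exp]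
      ring
    linarith
  have i1 : Integrable (fun z => log (k (z.1 + z.2)) - l * log (f z.1)) ρ :=
    ik.sub (jf.const_mul l)
  have i2 : Integrable (fun z => log (k (z.1 + z.2)) - l * log (f z.1) -
      (1 - l) * log (g z.2)) ρ := i1.sub (jg.const_mul (1 - l))
  have hmono := integral_mono_ae (i2.add (iW.const_mul c))
    ((hRi.div_const (C ^ d)).add (integrable_const _)) hle
  have hL : ∫ z, (log (k (z.1 + z.2)) - l * log (f z.1) - (1 - l) * log (g z.2) +
      c * ∑ i, S z.1 i * T z.2 i) ∂ρ =
        -shannonH d k + l * shannonH d f + (1 - l) * shannonH d g := by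
    rw [integral_add i2 (iW.const_mul c),
      integral_sub i1 (jg.const_mul (1 - l)),
      integral_sub ik (jf.const_mul l), integral_const_mul, integral_const_mul, integral_const_mul,
      vk, vf, vg, vW]
    ring
  have hU : ∫ z, (R z / C ^ d + (log (C ^ d) - 1)) ∂ρ ≤ d * log C := by
    rw [integral_add (hRi.div_const (C ^ d)) (integrable_const _), integral_div, integral_const,
      log_pow]
    have := (div_le_one hC).2 hRint
    simp only [probReal_univ, one_smul]
    linarith
  have := hL.symm.le.trans (hmono.trans hU)
  linarith

/-- **Shannon–Stam entropy power inequality.** For densities `f, g` on `ℝ^d` with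
finite differential entropies such that `f⋆g` has well-defined differential
entropy, `V(f⋆g) ≥ V(f) + V(g)`. -/
theorem shannon_stam_entropy_power_inequality (d : ℕ) (hd : 1 ≤ d)
    (f g : (Fin d → ℝ) → ℝ) (hf : IsDensity d f) (hg : IsDensity d g)
    (hfent : Integrable (fun x : Fin d → ℝ => f x * Real.log (f x)))
    (hgent : Integrable (fun x : Fin d → ℝ => g x * Real.log (g x)))
    (hhent : Integrable (fun x : Fin d → ℝ =>
      conv d f g x * Real.log (conv d f g x))) :
    shannonV d (conv d f g) ≥ shannonV d f + shannonV d g := by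
  have hd0 : (0 : ℝ) < d := by exact_mod_cast hd
  have hVf : 0 < shannonV d f := exp_pos _
  have hVg : 0 < shannonV d g := exp_pos _
  have lf : log (shannonV d f) = 2 / d * shannonH d f := log_exp _
  have lg : log (shannonV d g) = 2 / d * shannonH d g := log_exp _
  set a := shannonV d f
  set b := shannonV d g
  have hab : 0 < a + b := add_pos hVf hVg
  set l := a / (a + b) with hl
  have h0 : 0 < l := div_pos hVf hab
  have hm : 1 - l = b / (a + b) := by rw [hl]; field_simp; ring
  have hm0 : 0 < 1 - l := by rw [hm]; exact div_pos hVg hab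
  have key := shannonH_conv_ge h0 (by linarith) hf hg hfent hgent hhent
  have hlog : log (√l ^ l * √(1 - l) ^ (1 - l)) =
      (l * (log a - log (a + b)) + (1 - l) * (log b - log (a + b))) / 2 := by
    rw [log_mul (by positivity) (by positivity), log_rpow (sqrt_pos.2 h0),
      log_rpow (sqrt_pos.2 hm0), log_sqrt h0.le, log_sqrt hm0.le,
      ← log_div hVf.ne' hab.ne', ← log_div hVg.ne' hab.ne', ← hm]
    ring
  rw [hlog, lf, lg] at key
  change a + b ≤ exp (2 / d * shannonH d (conv d f g))
  rw [← log_le_iff_le_exp hab]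
  calc log (a + b) = 2 / d * (l * shannonH d f + (1 - l) * shannonH d g -
        d * ((l * (2 / d * shannonH d f - log (a + b)) +
          (1 - l) * (2 / d * shannonH d g - log (a + b))) / 2)) := by
        field_simp
        ring
    _ ≤ 2 / d * shannonH d (conv d f g) := by gcongr
end
end
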